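/- Let (G, C0, φ0) be a minimal counterexample to the extension theorem (minimizing |V(G)| + |E(G)|), with G embedded in the plane so that the chordless cycle C0 bounds the outer face. Then every internal vertex of G (a vertex not on the outer face) has degree at least 3. -/

import Mathlib

open SimpleGraph

namespace IFPaper

variable {V : Type}

/-- An `(I,F)`-coloring of a graph, encoded as a Boolean coloring where
`true` means color `I` and `false` means color `F`:  the `I`-colored vertices
form an independent set and the `F`-colored vertices induce a forest
(no cycle has all of its vertices colored `F`). -/
def IFColoring (G : SimpleGraph V) (c : V → Bool) : Prop :=
  (∀ ⦃u v : V⦄, G.Adj u v → c u = true → c v = false) ∧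
  (∀ (v : V) (w : G.Walk v v), w.IsCycle → ¬ (∀ x ∈ w.support, c x = false))

/-- A graph is `(I,F)`-colorable if it admits an `(I,F)`-coloring. -/
def IFColorable (G : SimpleGraph V) : Prop := ∃ c : V → Bool, IFColoring G c

/-- An `(I,F)`-coloring of the subgraph of `G` induced on the set `S`. -/
def IFColoringOn (G : SimpleGraph V) (S : Set V) (c : V → Bool) : Prop :=
  (∀ ⦃u v : V⦄, u ∈ S → v ∈ S → G.Adj u v → c u = true → c v = false) ∧
  (∀ (v : V) (w : G.Walk v v), w.IsCycle → (∀ x ∈ w.support, x ∈ S) →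
    ¬ (∀ x ∈ w.support, c x = false))

/-- A splitting `F`-path of (the vertex set `Q` of) a cycle: a path all of whose
vertices get color `F`, whose two endpoints lie on `Q`, and all of whose other
vertices (at least one) do not lie on `Q`. -/
def IsSplittingFPath (G : SimpleGraph V) (Q : Set V) (c : V → Bool)
    {a b : V} (p : G.Walk a b) : Prop :=
  p.IsPath ∧ (∀ x ∈ p.support, c x = false) ∧ a ∈ Q ∧ b ∈ Q ∧ 2 ≤ p.length ∧
  ∀ x ∈ p.support, x ≠ a → x ≠ b → x ∉ Q

/-- A super IF-coloring of `(G, Q)`: an `(I,F)`-coloring of `G` with no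
splitting `F`-path of `Q`. -/
def SuperIFColoring (G : SimpleGraph V) (Q : Set V) (c : V → Bool) : Prop :=
  IFColoring G c ∧ ∀ (a b : V) (p : G.Walk a b), ¬ IsSplittingFPath G Q c p

/-- `d* ≥ 3`: any two distinct cycles of length at most `5` are at distance at
least `3`. -/
def Cycles5Apart (G : SimpleGraph V) : Prop :=
  ∀ ⦃u v : V⦄ (c1 : G.Walk u u) (c2 : G.Walk v v),
    c1.IsCycle → c2.IsCycle → c1.length ≤ 5 → c2.length ≤ 5 →
    {e : Sym2 V | e ∈ c1.edges} ≠ {e : Sym2 V | e ∈ c2.edges} →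
    ∀ x ∈ c1.support, ∀ y ∈ c2.support, 3 ≤ G.dist x y

/-- A claw of the cycle `C`: a vertex not on `C` with three neighbors on `C`. -/
def HasClaw (G : SimpleGraph V) {v : V} (C : G.Walk v v) : Prop :=
  ∃ x : V, x ∉ C.support ∧ ∃ a b c : V, a ∈ C.support ∧ b ∈ C.support ∧ c ∈ C.support ∧
    a ≠ b ∧ a ≠ c ∧ b ≠ c ∧ G.Adj x a ∧ G.Adj x b ∧ G.Adj x c

/-- A triclaw of the cycle `C`: a triangle `x y z` disjoint from `C`, joined by
three edges to three distinct vertices of `C`. -/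
def HasTriclaw (G : SimpleGraph V) {v : V} (C : G.Walk v v) : Prop :=
  ∃ x y z : V, x ∉ C.support ∧ y ∉ C.support ∧ z ∉ C.support ∧
    G.Adj x y ∧ G.Adj y z ∧ G.Adj x z ∧
    ∃ a b c : V, a ∈ C.support ∧ b ∈ C.support ∧ c ∈ C.support ∧
      a ≠ b ∧ a ≠ c ∧ b ≠ c ∧ G.Adj x a ∧ G.Adj y b ∧ G.Adj z c

/-- A bad cycle is a `9`-cycle having a claw or a triclaw. -/
def IsBadCycle (G : SimpleGraph V) {v : V} (C : G.Walk v v) : Prop :=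
  C.IsCycle ∧ C.length = 9 ∧ (HasClaw G C ∨ HasTriclaw G C)

/-- A good cycle is a cycle that is not bad. -/
def IsGoodCycle (G : SimpleGraph V) {v : V} (C : G.Walk v v) : Prop :=
  C.IsCycle ∧ ¬ IsBadCycle G C

/-- The interior of an arc parametrized by `[0,1]`. -/
def ArcInterior (γ : ℝ → ℝ × ℝ) : Set (ℝ × ℝ) := γ '' Set.Ioo 0 1

/-- The image of an arc parametrized by `[0,1]`. -/
def ArcImage (γ : ℝ → ℝ × ℝ) : Set (ℝ × ℝ) := γ '' Set.Icc 0 1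

/-- A plane embedding of a simple graph: an injective placement of the vertices
in the plane together with, for every edge, a simple arc joining the images of
its endpoints, such that arcs meet only at common endpoints and no arc passes
through a vertex. -/
structure IsPlaneEmbedding (G : SimpleGraph V) (vtx : V → ℝ × ℝ)
    (arc : V → V → ℝ → ℝ × ℝ) : Prop where
  vtx_inj : Function.Injective vtx
  arc_cont : ∀ ⦃u v : V⦄, G.Adj u v → ContinuousOn (arc u v) (Set.Icc 0 1)
  arc_injOn : ∀ ⦃u v : V⦄, G.Adj u v → Set.InjOn (arc u v) (Set.Icc 0 1)
  arc_start : ∀ ⦃u v : V⦄, G.Adj u v → arc u v 0 = vtx u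
  arc_end : ∀ ⦃u v : V⦄, G.Adj u v → arc u v 1 = vtx v
  arc_symm : ∀ ⦃u v : V⦄, G.Adj u v → ∀ t : ℝ, arc v u t = arc u v (1 - t)
  arc_avoids_vtx : ∀ ⦃u v : V⦄, G.Adj u v → ∀ w : V, vtx w ∉ ArcInterior (arc u v)
  arc_disjoint : ∀ ⦃u v u' v' : V⦄, G.Adj u v → G.Adj u' v' → s(u, v) ≠ s(u', v') →
    ArcInterior (arc u v) ∩ ArcInterior (arc u' v') = ∅

/-- A graph is planar if it admits a plane embedding. -/
def IsPlanarGraph (G : SimpleGraph V) : Prop :=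
  ∃ (vtx : V → ℝ × ℝ) (arc : V → V → ℝ → ℝ × ℝ), IsPlaneEmbedding G vtx arc

/-- The subset of the plane covered by a plane drawing of `G`. -/
def Drawing (G : SimpleGraph V) (vtx : V → ℝ × ℝ) (arc : V → V → ℝ → ℝ × ℝ) :
    Set (ℝ × ℝ) :=
  Set.range vtx ∪ ⋃ (u : V) (v : V) (_ : G.Adj u v), ArcImage (arc u v)

/-- The subset of the plane covered by the drawing of a walk `w`. -/
def WalkDrawing (G : SimpleGraph V) (arc : V → V → ℝ → ℝ × ℝ)
    {a b : V} (w : G.Walk a b) : Set (ℝ × ℝ) :=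
  ⋃ (u : V) (v : V) (_ : G.Adj u v) (_ : s(u, v) ∈ w.edges), ArcImage (arc u v)

/-- A face of a plane drawing: a connected component of the complement of the
drawing. -/
def IsFace (G : SimpleGraph V) (vtx : V → ℝ × ℝ) (arc : V → V → ℝ → ℝ × ℝ)
    (f : Set (ℝ × ℝ)) : Prop :=
  ∃ p : ℝ × ℝ, p ∉ Drawing G vtx arc ∧
    f = connectedComponentIn (Drawing G vtx arc)ᶜ p

/-- The outer face: the unbounded face. -/
def IsOuterFace (G : SimpleGraph V) (vtx : V → ℝ × ℝ) (arc : V → V → ℝ → ℝ × ℝ)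
    (f : Set (ℝ × ℝ)) : Prop :=
  IsFace G vtx arc f ∧ ¬ Bornology.IsBounded f

/-- A vertex is on a face if its image lies on the boundary of the face. -/
def VertexOnFace (vtx : V → ℝ × ℝ) (f : Set (ℝ × ℝ)) (v : V) : Prop :=
  vtx v ∈ frontier f

/-- The face `f` is bounded by the (closed) walk `w`. -/
def FaceBoundedBy (G : SimpleGraph V) (vtx : V → ℝ × ℝ) (arc : V → V → ℝ → ℝ × ℝ)
    (f : Set (ℝ × ℝ)) {a : V} (w : G.Walk a a) : Prop :=
  IsFace G vtx arc f ∧ frontier f = WalkDrawing G arc w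

/-- A vertex lies (strictly) inside the cycle `C` of the plane graph. -/
def VertexInsideCycle (G : SimpleGraph V) (vtx : V → ℝ × ℝ)
    (arc : V → V → ℝ → ℝ × ℝ) {a : V} (C : G.Walk a a) (v : V) : Prop :=
  vtx v ∉ WalkDrawing G arc C ∧
  Bornology.IsBounded (connectedComponentIn (WalkDrawing G arc C)ᶜ (vtx v))

/-- A vertex lies (strictly) outside the cycle `C` of the plane graph. -/
def VertexOutsideCycle (G : SimpleGraph V) (vtx : V → ℝ × ℝ)
    (arc : V → V → ℝ → ℝ × ℝ) {a : V} (C : G.Walk a a) (v : V) : Prop :=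
  vtx v ∉ WalkDrawing G arc C ∧
  ¬ Bornology.IsBounded (connectedComponentIn (WalkDrawing G arc C)ᶜ (vtx v))

/-- A cycle of a plane graph is separating if its interior and its exterior
each contain a vertex of the graph. -/
def IsSeparatingCycle (G : SimpleGraph V) (vtx : V → ℝ × ℝ)
    (arc : V → V → ℝ → ℝ × ℝ) {a : V} (C : G.Walk a a) : Prop :=
  (∃ v : V, VertexInsideCycle G vtx arc C v) ∧
  (∃ v : V, VertexOutsideCycle G vtx arc C v)

/-- The cycle `C` has no chord in `G`. -/
def Chordless (G : SimpleGraph V) {a : V} (C : G.Walk a a) : Prop :=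
  ∀ ⦃u v : V⦄, u ∈ C.support → v ∈ C.support → G.Adj u v → s(u, v) ∈ C.edges

/-- The precoloring `c0` of the cycle `C0` extends to a super IF-coloring of
`(G, C0)`. -/
def ExtendsToSuper (G : SimpleGraph V) {v0 : V} (C0 : G.Walk v0 v0)
    (c0 : V → Bool) : Prop :=
  ∃ c : V → Bool, SuperIFColoring G {x | x ∈ C0.support} c ∧
    ∀ x ∈ C0.support, c x = c0 x

/-- A counterexample to the extension theorem: a planar graph with `d* ≥ 3`, a
good cycle `C0` of length at most `9`, and an `(I,F)`-coloring of `G[V(C0)]`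
which does not extend to a super IF-coloring of `(G, C0)`. -/
def IsCounterexample (G : SimpleGraph V) {v0 : V} (C0 : G.Walk v0 v0)
    (c0 : V → Bool) : Prop :=
  IsPlanarGraph G ∧ Cycles5Apart G ∧ IsGoodCycle G C0 ∧ C0.length ≤ 9 ∧
  IFColoringOn G {x | x ∈ C0.support} c0 ∧ ¬ ExtendsToSuper G C0 c0

/-- The quantity `|V(G)| + |E(G)|`. -/
noncomputable def graphSize {V : Type} [Fintype V] (G : SimpleGraph V) : ℕ :=
  Fintype.card V + G.edgeSet.ncard

/-- A minimal counterexample to the extension theorem: one minimizing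
`|V(G)| + |E(G)|` among all counterexamples. -/
def IsMinimalCounterexample [Fintype V] (G : SimpleGraph V) {v0 : V}
    (C0 : G.Walk v0 v0) (c0 : V → Bool) : Prop :=
  IsCounterexample G C0 c0 ∧
  ∀ (n : ℕ) (G' : SimpleGraph (Fin n)) (v0' : Fin n) (C0' : G'.Walk v0' v0')
    (c0' : Fin n → Bool), IsCounterexample G' C0' c0' →
      graphSize G ≤ graphSize G'

/-- A chord of the cycle `C` splitting it into two cycles of lengths `l1` and
`l2`: an edge between two non-consecutive vertices of `C` together with two
cycles of lengths `l1` and `l2` which both use the chord, use otherwise only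
edges of `C`, and together partition the edges of `C`. -/
def HasChordSplit (G : SimpleGraph V) {a : V} (C : G.Walk a a) (l1 l2 : ℕ) : Prop :=
  ∃ u v : V, u ∈ C.support ∧ v ∈ C.support ∧ G.Adj u v ∧ s(u, v) ∉ C.edges ∧
    ∃ (c1 c2 : G.Walk u u), c1.IsCycle ∧ c2.IsCycle ∧
      c1.length = l1 ∧ c2.length = l2 ∧
      s(u, v) ∈ c1.edges ∧ s(u, v) ∈ c2.edges ∧
      (∀ e ∈ c1.edges, e ≠ s(u, v) → e ∈ C.edges) ∧
      (∀ e ∈ c2.edges, e ≠ s(u, v) → e ∈ C.edges) ∧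
      (∀ e ∈ C.edges, (e ∈ c1.edges ↔ e ∉ c2.edges))

/-- A `(l1, l2, l3)`-claw of the cycle `C`: a claw which together with `C`
forms three cycles of lengths `l1`, `l2` and `l3`. -/
def HasClawSplit (G : SimpleGraph V) {a : V} (C : G.Walk a a) (l1 l2 l3 : ℕ) : Prop :=
  ∃ x : V, x ∉ C.support ∧ ∃ v1 v2 v3 : V,
    v1 ∈ C.support ∧ v2 ∈ C.support ∧ v3 ∈ C.support ∧
    v1 ≠ v2 ∧ v1 ≠ v3 ∧ v2 ≠ v3 ∧ G.Adj x v1 ∧ G.Adj x v2 ∧ G.Adj x v3 ∧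
    ∃ (w1 w2 w3 : G.Walk x x), w1.IsCycle ∧ w2.IsCycle ∧ w3.IsCycle ∧
      w1.length = l1 ∧ w2.length = l2 ∧ w3.length = l3 ∧
      (∀ e ∈ w1.edges, e ∈ C.edges ∨ e = s(x, v1) ∨ e = s(x, v2) ∨ e = s(x, v3)) ∧
      (∀ e ∈ w2.edges, e ∈ C.edges ∨ e = s(x, v1) ∨ e = s(x, v2) ∨ e = s(x, v3)) ∧
      (∀ e ∈ w3.edges, e ∈ C.edges ∨ e = s(x, v1) ∨ e = s(x, v2) ∨ e = s(x, v3)) ∧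
      (∀ e ∈ C.edges, (e ∈ w1.edges ∧ e ∉ w2.edges ∧ e ∉ w3.edges) ∨
        (e ∉ w1.edges ∧ e ∈ w2.edges ∧ e ∉ w3.edges) ∨
        (e ∉ w1.edges ∧ e ∉ w2.edges ∧ e ∈ w3.edges))

/-- A special `9`-cycle: a `9`-cycle having a `(3,8)`-chord or a
`(5,5,5)`-claw. -/
def IsSpecial9Cycle (G : SimpleGraph V) {a : V} (C : G.Walk a a) : Prop :=
  C.IsCycle ∧ C.length = 9 ∧ (HasChordSplit G C 3 8 ∨ HasClawSplit G C 5 5 5)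

/-- Two cycles are normally adjacent if they share exactly one edge and
exactly two vertices. -/
def NormallyAdjacent (G : SimpleGraph V) {a b : V}
    (c1 : G.Walk a a) (c2 : G.Walk b b) : Prop :=
  (∃ e : Sym2 V, {e' : Sym2 V | e' ∈ c1.edges} ∩ {e' : Sym2 V | e' ∈ c2.edges} = {e}) ∧
  (∃ x y : V, x ≠ y ∧ {z : V | z ∈ c1.support} ∩ {z : V | z ∈ c2.support} = {x, y})

/-- A `3`-fold cover `(H, L)` of `G`. -/
def IsDPCover (G : SimpleGraph V) {W : Type} (H : SimpleGraph W)
    (L : V → Finset W) : Prop :=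
  (∀ v : V, (L v).card = 3) ∧
  (∀ ⦃u v : V⦄, u ≠ v → Disjoint (L u) (L v)) ∧
  (∀ v : V, ∀ a ∈ L v, ∀ b ∈ L v, ¬ H.Adj a b) ∧
  (∀ ⦃a b : W⦄, H.Adj a b → ∃ u v : V, G.Adj u v ∧ a ∈ L u ∧ b ∈ L v) ∧
  (∀ ⦃u v : V⦄, u ≠ v → ∀ a ∈ L u, ∀ b ∈ L v, ∀ b' ∈ L v,
    H.Adj a b → H.Adj a b' → b = b')

/-- `G` is DP-`3`-colorable: for every `3`-fold cover `(H, L)` of `G` there is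
an independent transversal picking one vertex from each fiber. -/
def DP3Colorable (G : SimpleGraph V) : Prop :=
  ∀ (W : Type) (H : SimpleGraph W) (L : V → Finset W), IsDPCover G H L →
    ∃ f : V → W, (∀ v : V, f v ∈ L v) ∧ ∀ u v : V, ¬ H.Adj (f u) (f v)


/-- A walk between images of an embedding that stays in its range is the image
of a walk. -/
theorem exists_map_eq_of_support_subset_range {W : Type} {H : SimpleGraph W}
    {G : SimpleGraph V} (f : H ↪g G) {x y : V} (w : G.Walk x y)
    (hw : ∀ z ∈ w.support, z ∈ Set.range f) :
    ∀ (a b : W) (ha : f a = x) (hb : f b = y),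
      ∃ w' : H.Walk a b, (w'.map f.toHom).copy ha hb = w := by
  induction w with
  | nil =>
    rintro a b rfl hb
    obtain rfl := f.injective hb
    exact ⟨.nil, rfl⟩
  | @cons x z y hxz p ih =>
    rintro a b rfl rfl
    obtain ⟨c, rfl⟩ := hw z (by simp)
    obtain ⟨p', rfl⟩ := ih (fun t ht => hw t (by simp [ht])) c b rfl rfl
    exact ⟨.cons (f.map_adj_iff.1 hxz) p', rfl⟩

/-- A walk with endpoints `f a` and `f b` staying in the range of the embedding
`f` lifts along `f`. -/
theorem exists_map_eq {W : Type} {H : SimpleGraph W} {G : SimpleGraph V} (f : H ↪g G)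
    {a b : W} (w : G.Walk (f a) (f b)) (hw : ∀ z ∈ w.support, z ∈ Set.range f) :
    ∃ w' : H.Walk a b, w'.map f.toHom = w :=
  exists_map_eq_of_support_subset_range f w hw a b rfl rfl

theorem IsPlanarGraph.of_embedding {W : Type} {H : SimpleGraph W} {G : SimpleGraph V}
    (f : H ↪g G) (hG : IsPlanarGraph G) : IsPlanarGraph H := by
  obtain ⟨vtx, arc, h⟩ := hG
  refine ⟨fun a => vtx (f a), fun a b => arc (f a) (f b), ?_⟩
  have adj : ∀ {a b : W}, H.Adj a b → G.Adj (f a) (f b) := fun h => f.map_adj_iff.2 h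
  exact
    { vtx_inj := h.vtx_inj.comp f.injective
      arc_cont := fun _ _ hab => h.arc_cont (adj hab)
      arc_injOn := fun _ _ hab => h.arc_injOn (adj hab)
      arc_start := fun _ _ hab => h.arc_start (adj hab)
      arc_end := fun _ _ hab => h.arc_end (adj hab)
      arc_symm := fun _ _ hab => h.arc_symm (adj hab)
      arc_avoids_vtx := fun _ _ hab w => h.arc_avoids_vtx (adj hab) (f w)
      arc_disjoint := fun a b a' b' hab hab' hne => h.arc_disjoint (adj hab) (adj hab') fun he =>
        hne (Sym2.map.injective f.injective (by simpa using he)) }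

/-- Distinct short cycles inside `S` are joined by walks inside `S`. -/
def ShortCyclesJoinedIn (G : SimpleGraph V) (S : Set V) : Prop :=
  ∀ ⦃u v : V⦄ (c1 : G.Walk u u) (c2 : G.Walk v v),
    c1.IsCycle → c2.IsCycle → c1.length ≤ 5 → c2.length ≤ 5 →
    {e : Sym2 V | e ∈ c1.edges} ≠ {e : Sym2 V | e ∈ c2.edges} →
    (∀ x ∈ c1.support, x ∈ S) → (∀ x ∈ c2.support, x ∈ S) →
    ∀ x ∈ c1.support, ∀ y ∈ c2.support, ∃ w : G.Walk x y, ∀ z ∈ w.support, z ∈ S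

theorem Cycles5Apart.of_embedding {W : Type} {H : SimpleGraph W} {G : SimpleGraph V}
    (f : H ↪g G) (hG : Cycles5Apart G) (hS : ShortCyclesJoinedIn G (Set.range f)) :
    Cycles5Apart H := by
  intro u v c1 c2 h1 h2 l1 l2 hne x hx y hy
  have edge_image : ∀ {a : W} (c : H.Walk a a),
      {e | e ∈ (c.map f.toHom).edges} = Sym2.map f '' {e | e ∈ c.edges} := by
    intro a c
    ext e
    simp [Walk.edges_map]
  have hne' : {e | e ∈ (c1.map f.toHom).edges} ≠ {e | e ∈ (c2.map f.toHom).edges} := by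
    rw [edge_image, edge_image]
    exact fun h => hne ((Sym2.map.injective f.injective).image_injective h)
  have range_of_mem : ∀ {a : W} (c : H.Walk a a), ∀ z ∈ (c.map f.toHom).support,
      z ∈ Set.range f := by
    intro a c z hz
    rw [Walk.support_map, List.mem_map] at hz
    obtain ⟨t, -, rfl⟩ := hz
    exact ⟨t, rfl⟩
  have hx' : f x ∈ (c1.map f.toHom).support := by
    rw [Walk.support_map]
    exact List.mem_map_of_mem hx
  have hy' : f y ∈ (c2.map f.toHom).support := by
    rw [Walk.support_map]
    exact List.mem_map_of_mem hy
  have h1' : (c1.map f.toHom).IsCycle := h1.map f.injective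
  have h2' : (c2.map f.toHom).IsCycle := h2.map f.injective
  have l1' : (c1.map f.toHom).length ≤ 5 := by simpa using l1
  have l2' : (c2.map f.toHom).length ≤ 5 := by simpa using l2
  have hd := hG _ _ h1' h2' l1' l2' hne' _ hx' _ hy'
  obtain ⟨w, hw⟩ := hS _ _ h1' h2' l1' l2' hne' (range_of_mem c1) (range_of_mem c2) _ hx' _ hy'
  obtain ⟨w', -⟩ := exists_map_eq f w hw
  obtain ⟨p, hp⟩ := w'.reachable.exists_walk_length_eq_dist
  have hle := dist_le (p.map f.toHom)
  rw [Walk.length_map, hp] at hle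
  exact hd.trans hle

theorem IsGoodCycle.of_map {W : Type} {H : SimpleGraph W} {G : SimpleGraph V}
    (f : H ↪g G) {a : W} {C : H.Walk a a} (hC : IsGoodCycle G (C.map f.toHom)) :
    IsGoodCycle H C := by
  have hcyc : C.IsCycle := hC.1.of_map
  have mem : ∀ x, f x ∈ (C.map f.toHom).support ↔ x ∈ C.support := by
    intro x
    rw [Walk.support_map]
    exact List.mem_map_of_injective f.injective
  have adj : ∀ {a b : W}, H.Adj a b → G.Adj (f a) (f b) := fun h => f.map_adj_iff.2 h
  have ne : ∀ {a b : W}, a ≠ b → f a ≠ f b := fun h => f.injective.ne h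
  refine ⟨hcyc, fun ⟨_, hl, hb⟩ => hC.2 ⟨hC.1, by simpa using hl, ?_⟩⟩
  rcases hb with ⟨x, hx, a, b, c, ha, hb, hc, hab, hac, hbc, xa, xb, xc⟩ |
    ⟨x, y, z, hx, hy, hz, xy, yz, xz, a, b, c, ha, hb, hc, hab, hac, hbc, xa, yb, zc⟩
  · exact .inl ⟨f x, by rwa [mem], f a, f b, f c, (mem _).2 ha, (mem _).2 hb, (mem _).2 hc,
      ne hab, ne hac, ne hbc, adj xa, adj xb, adj xc⟩
  · exact .inr ⟨f x, f y, f z, by rwa [mem], by rwa [mem], by rwa [mem], adj xy, adj yz, adj xz,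
      f a, f b, f c, (mem _).2 ha, (mem _).2 hb, (mem _).2 hc, ne hab, ne hac, ne hbc,
      adj xa, adj yb, adj zc⟩

theorem graphSize_lt_of_embedding [Fintype V] {n : ℕ} {H : SimpleGraph (Fin n)}
    {G : SimpleGraph V} (f : H ↪g G) (hn : n < Fintype.card V) : graphSize H < graphSize G := by
  have hle : H.edgeSet.ncard ≤ G.edgeSet.ncard := by
    refine Set.ncard_le_ncard_of_injOn (Sym2.map f) ?_
      (Sym2.map.injective f.injective).injOn (Set.toFinite _)
    intro e he
    induction e with
    | _ a b => exact f.map_adj_iff.2 he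
  simp only [graphSize, Fintype.card_fin]
  omega

/-- A super IF-coloring of the subgraph of `G` induced on `S`, with respect to
`Q`. -/
def SuperIFColoringOn (G : SimpleGraph V) (S Q : Set V) (c : V → Bool) : Prop :=
  IFColoringOn G S c ∧ ∀ (a b : V) (p : G.Walk a b), (∀ x ∈ p.support, x ∈ S) →
    ¬ IsSplittingFPath G Q c p

/-- Precolorings of good cycles extend to every proper induced subgraph of a
minimal counterexample whose short cycles are joined inside it. -/
theorem IsMinimalCounterexample.exists_superIFColoringOn [Fintype V] {G : SimpleGraph V}
    {v0 : V} {C0 : G.Walk v0 v0} {φ0 : V → Bool} (hmin : IsMinimalCounterexample G C0 φ0)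
    {S : Set V} (hS : S ≠ Set.univ) (hjoin : ShortCyclesJoinedIn G S)
    {u : V} (C : G.Walk u u) (hCS : ∀ x ∈ C.support, x ∈ S) (hgood : IsGoodCycle G C)
    (hlen : C.length ≤ 9) {φ : V → Bool} (hφ : IFColoringOn G {x | x ∈ C.support} φ) :
    ∃ c : V → Bool, SuperIFColoringOn G S {x | x ∈ C.support} c ∧
      ∀ x ∈ C.support, c x = φ x := by
  classical
  obtain ⟨g⟩ : Nonempty (Fin (Fintype.card S) ≃ S) := ⟨(Fintype.equivFin S).symm⟩
  let e : Fin (Fintype.card S) ↪ V := g.toEmbedding.trans (Function.Embedding.subtype _)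
  let f : G.comap e ↪g G := SimpleGraph.Embedding.comap e G
  have hrange : Set.range f = S := by
    ext x
    constructor
    · rintro ⟨a, rfl⟩
      exact (g a).2
    · intro hx
      exact ⟨g.symm ⟨x, hx⟩, by simp [f, e]⟩
  rw [← hrange] at hjoin hCS ⊢
  have hcard : Fintype.card S < Fintype.card V := by
    obtain ⟨x, hx⟩ := (Set.ne_univ_iff_exists_notMem S).1 hS
    exact Fintype.card_subtype_lt hx
  have hsize := graphSize_lt_of_embedding f hcard
  obtain ⟨u, rfl⟩ := hCS _ C.start_mem_support
  obtain ⟨C, rfl⟩ := exists_map_eq f C hCS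
  have mem : ∀ {a b : Fin (Fintype.card S)} (w : (G.comap e).Walk a b) (x),
      f x ∈ (w.map f.toHom).support ↔ x ∈ w.support := by
    intro a b w x
    rw [Walk.support_map]
    exact List.mem_map_of_injective f.injective
  have hφ' : IFColoringOn (G.comap e) {x | x ∈ C.support} (φ ∘ f) := by
    refine ⟨fun a b ha hb hab => hφ.1 ((mem C a).2 ha) ((mem C b).2 hb) hab, ?_⟩
    intro a w hw hwC hF
    refine hφ.2 _ (w.map f.toHom) (hw.map f.injective) ?_ ?_ <;>
    · intro x hx
      rw [Walk.support_map, List.mem_map] at hx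
      obtain ⟨t, ht, rfl⟩ := hx
      first
        | exact (mem C t).2 (hwC t ht)
        | exact hF t ht
  have hext : ExtendsToSuper (G.comap e) C (φ ∘ f) := by
    by_contra hext
    exact (hmin.2 _ _ _ C (φ ∘ f) ⟨hmin.1.1.of_embedding f, hmin.1.2.1.of_embedding f hjoin,
      hgood.of_map f, by simpa using hlen, hφ', hext⟩).not_gt hsize
  obtain ⟨c, ⟨⟨hI, hF⟩, hsplit⟩, hagree⟩ := hext
  have hcf : ∀ a, Function.extend f c (fun _ => false) (f a) = c a :=
    fun a => f.injective.extend_apply _ _ _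
  refine ⟨Function.extend f c fun _ => false, ⟨⟨?_, ?_⟩, ?_⟩, ?_⟩
  · rintro _ _ ⟨a, rfl⟩ ⟨b, rfl⟩ hab
    rw [hcf, hcf]
    exact hI hab
  · intro x w hw hwS hwF
    obtain ⟨a, rfl⟩ := hwS _ w.start_mem_support
    obtain ⟨w, rfl⟩ := exists_map_eq f w hwS
    refine hF a w hw.of_map fun x hx => ?_
    rw [← hcf]
    exact hwF _ ((mem w x).2 hx)
  · rintro x y p hpS ⟨hp, hpF, hx, hy, hl, hint⟩
    obtain ⟨a, rfl⟩ := hpS _ p.start_mem_support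
    obtain ⟨b, rfl⟩ := hpS _ p.end_mem_support
    obtain ⟨p, rfl⟩ := exists_map_eq f p hpS
    refine hsplit a b p ⟨hp.of_map, fun x hx => ?_, (mem C a).1 hx, (mem C b).1 hy,
      by simpa using hl, fun x hx hxa hxb hxC => ?_⟩
    · rw [← hcf]
      exact hpF _ ((mem p x).2 hx)
    · exact hint _ ((mem p x).2 hx) (f.injective.ne hxa) (f.injective.ne hxb) ((mem C x).2 hxC)
  · intro x hx
    obtain ⟨a, rfl⟩ := hCS x hx
    rw [hcf]
    exact hagree a ((mem C a).1 hx)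

/-- An inner vertex of a path has two distinct neighbors on the path. -/
theorem exists_two_adj_of_mem_isPath {G : SimpleGraph V} {a b v : V} {p : G.Walk a b}
    (hp : p.IsPath) (hv : v ∈ p.support) (hva : v ≠ a) (hvb : v ≠ b) :
    ∃ x ∈ p.support, ∃ y ∈ p.support, x ≠ y ∧ G.Adj v x ∧ G.Adj v y := by
  obtain ⟨q, r, rfl⟩ := Walk.mem_support_iff_exists_append.1 hv
  have hq : ¬ q.Nil := Walk.not_nil_of_ne hva.symm
  have hr : ¬ r.Nil := Walk.not_nil_of_ne hvb
  refine ⟨q.penultimate, ?_, r.snd, ?_, fun he => ?_, (q.adj_penultimate hq).symm, r.adj_snd hr⟩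
  · exact Walk.mem_support_append_iff _ _ |>.2 (.inl (q.getVert_mem_support _))
  · exact Walk.mem_support_append_iff _ _ |>.2 (.inr (r.getVert_mem_support _))
  · have hnd := hp.support_nodup
    rw [Walk.support_append] at hnd
    exact List.disjoint_of_nodup_append hnd (q.getVert_mem_support _)
      (he ▸ Walk.snd_mem_tail_support hr)

/-- A vertex of a cycle has two distinct neighbors on the cycle. -/
theorem exists_two_adj_of_mem_isCycle {G : SimpleGraph V} {a v : V} {w : G.Walk a a}
    (hw : w.IsCycle) (hv : v ∈ w.support) :
    ∃ x ∈ w.support, ∃ y ∈ w.support, x ≠ y ∧ G.Adj v x ∧ G.Adj v y := by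
  classical
  have h := hw.rotate hv
  refine ⟨(w.rotate v hv).snd, ?_, (w.rotate v hv).penultimate, ?_, h.snd_ne_penultimate,
    Walk.adj_snd h.not_nil, (Walk.adj_penultimate h.not_nil).symm⟩ <;>
  exact (Walk.mem_support_rotate_iff w v hv).1 (Walk.getVert_mem_support _ _)

theorem eq_or_eq_or_eq_of_degree_lt_three {G : SimpleGraph V} {v : V}
    [Fintype (G.neighborSet v)] (hdeg : G.degree v < 3) {x y z : V}
    (hx : G.Adj v x) (hy : G.Adj v y) (hz : G.Adj v z) : x = y ∨ x = z ∨ y = z := by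
  by_contra! h
  refine hdeg.not_ge (Finset.two_lt_card_iff.2 ⟨x, y, z, ?_, ?_, ?_, h⟩) <;> simpa

/-- A super IF-coloring of `G - v` extends to the vertex `v` of degree at most
two. -/
theorem SuperIFColoringOn.extend_vertex {G : SimpleGraph V} {v : V}
    [Fintype (G.neighborSet v)] (hdeg : G.degree v < 3) {Q : Set V} (hvQ : v ∉ Q) {c : V → Bool}
    (hc : SuperIFColoringOn G {v}ᶜ Q c) :
    ∃ c' : V → Bool, SuperIFColoring G Q c' ∧ ∀ x ≠ v, c' x = c x := by
  classical
  obtain ⟨⟨hI, hF⟩, hsplit⟩ := hc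
  let c' : V → Bool := fun x => if x = v then decide (∀ y, G.Adj v y → c y = false) else c x
  have hne : ∀ x, x ≠ v → c' x = c x := fun x hx => if_neg hx
  have hcv : c' v = decide (∀ y, G.Adj v y → c y = false) := if_pos rfl
  have hF_unique : c' v = false → ∀ x y, G.Adj v x → G.Adj v y → c' x = false → c' y = false →
      x = y := by
    intro hv x y hx hy hxF hyF
    rw [hcv, decide_eq_false_iff_not] at hv
    push Not at hv
    obtain ⟨z, hz, hzI⟩ := hv
    rw [← hne z hz.ne'] at hzI
    rcases eq_or_eq_or_eq_of_degree_lt_three hdeg hx hy hz with h | rfl | rfl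
    · exact h
    · exact absurd hxF hzI
    · exact absurd hyF hzI
  refine ⟨c', ⟨⟨?_, ?_⟩, ?_⟩, hne⟩
  · intro x y hxy hx
    rcases eq_or_ne x v with rfl | hxv
    · rw [hne y hxy.ne']
      rw [hcv, decide_eq_true_iff] at hx
      exact hx y hxy
    rw [hne x hxv] at hx
    rcases eq_or_ne y v with rfl | hyv
    · rw [hcv, decide_eq_false_iff_not]
      intro h
      simp [h x hxy.symm] at hx
    · rw [hne y hyv]
      exact hI hxv hyv hxy hx
  · intro a w hw hwF
    by_cases hv : v ∈ w.support
    · obtain ⟨x, hx, y, hy, hxy, hvx, hvy⟩ := exists_two_adj_of_mem_isCycle hw hv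
      exact hxy (hF_unique (hwF v hv) x y hvx hvy (hwF x hx) (hwF y hy))
    · have hav : ∀ x ∈ w.support, x ≠ v := fun x hx h => hv (h ▸ hx)
      exact hF a w hw hav fun x hx => (hne x (hav x hx)).symm.trans (hwF x hx)
  · rintro a b p ⟨hp, hpF, ha, hb, hl, hint⟩
    by_cases hv : v ∈ p.support
    · obtain ⟨x, hx, y, hy, hxy, hvx, hvy⟩ := exists_two_adj_of_mem_isPath hp hv
        (fun h => hvQ (h ▸ ha)) (fun h => hvQ (h ▸ hb))
      exact hxy (hF_unique (hpF v hv) x y hvx hvy (hpF x hx) (hpF y hy))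
    · have hav : ∀ x ∈ p.support, x ≠ v := fun x hx h => hv (h ▸ hx)
      exact hsplit a b p hav
        ⟨hp, fun x hx => (hne x (hav x hx)).symm.trans (hpF x hx), ha, hb, hl, hint⟩

/-- Vertices joined by a walk in `G - v`. -/
def JoinedAvoiding (G : SimpleGraph V) (v x y : V) : Prop :=
  ∃ w : G.Walk x y, v ∉ w.support

theorem JoinedAvoiding.symm {G : SimpleGraph V} {v x y : V} (h : JoinedAvoiding G v x y) :
    JoinedAvoiding G v y x := by
  obtain ⟨w, hw⟩ := h
  exact ⟨w.reverse, by simpa using hw⟩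

theorem JoinedAvoiding.trans {G : SimpleGraph V} {v x y z : V} (h : JoinedAvoiding G v x y)
    (h' : JoinedAvoiding G v y z) : JoinedAvoiding G v x z := by
  obtain ⟨w, hw⟩ := h
  obtain ⟨w', hw'⟩ := h'
  exact ⟨w.append w', by simp [Walk.mem_support_append_iff, hw, hw']⟩

theorem joinedAvoiding_of_mem_support {G : SimpleGraph V} {v x y z : V} {w : G.Walk x y}
    (hw : v ∉ w.support) (hz : z ∈ w.support) : JoinedAvoiding G v x z := by
  classical
  exact ⟨w.takeUntil z hz, fun h => hw (w.support_takeUntil_subset_support hz h)⟩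

/-- If every walk from `x` to `y` meets `v`, then `x` reaches a neighbor of `v`
without meeting `v`. -/
theorem exists_adj_joinedAvoiding {G : SimpleGraph V} {v x y : V} (hxv : x ≠ v)
    (hxy : G.Reachable x y) (hnot : ¬ JoinedAvoiding G v x y) :
    ∃ a, G.Adj v a ∧ JoinedAvoiding G v x a := by
  obtain ⟨w⟩ := hxy
  induction w with
  | nil => exact absurd ⟨.nil, by simpa using hxv.symm⟩ hnot
  | @cons x z y hxz p ih =>
    rcases eq_or_ne z v with rfl | hzv
    · exact ⟨x, hxz.symm, .nil, by simpa using hxv.symm⟩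
    · have hstep : JoinedAvoiding G v x z := ⟨.cons hxz .nil, by simp [hxv.symm, hzv.symm]⟩
      obtain ⟨a, ha, hza⟩ := ih hzv fun h => hnot (hstep.trans h)
      exact ⟨a, ha, hstep.trans hza⟩

/-- At most two classes of vertices of `G - v` reach `v` in `G` when `v` has
degree at most two. -/
theorem joinedAvoiding_of_degree_lt_three {G : SimpleGraph V} {v : V}
    [Fintype (G.neighborSet v)] (hdeg : G.degree v < 3) {x y p q : V}
    (hxv : x ≠ v) (hpv : p ≠ v) (hqv : q ≠ v) (hxy : G.Reachable x y) (hpq : G.Reachable p q)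
    (hnxy : ¬ JoinedAvoiding G v x y) (hnxp : ¬ JoinedAvoiding G v x p)
    (hnxq : ¬ JoinedAvoiding G v x q) : JoinedAvoiding G v p q := by
  by_contra hnpq
  obtain ⟨a, ha, hxa⟩ := exists_adj_joinedAvoiding hxv hxy hnxy
  obtain ⟨b, hb, hpb⟩ := exists_adj_joinedAvoiding hpv hpq hnpq
  obtain ⟨d, hd, hqd⟩ := exists_adj_joinedAvoiding hqv hpq.symm fun h => hnpq h.symm
  rcases eq_or_eq_or_eq_of_degree_lt_three hdeg ha hb hd with rfl | rfl | rfl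
  · exact hnxp (hxa.trans hpb.symm)
  · exact hnxq (hxa.trans hqd.symm)
  · exact hnpq (hpb.trans hqd.symm)

theorem Cycles5Apart.reachable {G : SimpleGraph V} (hG : Cycles5Apart G) {u v : V}
    {c1 : G.Walk u u} {c2 : G.Walk v v} (h1 : c1.IsCycle) (h2 : c2.IsCycle)
    (l1 : c1.length ≤ 5) (l2 : c2.length ≤ 5)
    (hne : {e : Sym2 V | e ∈ c1.edges} ≠ {e : Sym2 V | e ∈ c2.edges})
    {x y : V} (hx : x ∈ c1.support) (hy : y ∈ c2.support) : G.Reachable x y := by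
  have h := hG c1 c2 h1 h2 l1 l2 hne x hx y hy
  exact Reachable.of_dist_ne_zero (by omega)

/-- Coloring one vertex of a short cycle with `I` and the others with `F` gives
an `(I,F)`-coloring of the subgraph induced on it. -/
theorem Cycles5Apart.ifColoringOn_support [DecidableEq V] {G : SimpleGraph V}
    (hG : Cycles5Apart G) {u : V} {C : G.Walk u u} (hC : C.IsCycle) (hl : C.length ≤ 5) :
    IFColoringOn G {x | x ∈ C.support} fun x => decide (x = u) := by
  refine ⟨?_, ?_⟩
  · intro x y _ _ hxy hx
    simp only [decide_eq_true_eq, decide_eq_false_iff_not] at hx ⊢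
    exact fun hy => hxy.ne (hx.trans hy.symm)
  · intro x w hw hwC hwF
    have hu : u ∉ w.support := fun h => by simpa using hwF u h
    have hwl : w.length ≤ 5 := by
      have hsub : w.support.tail ⊆ C.support.tail := by
        intro z hz
        have hz' := List.mem_of_mem_tail hz
        have := hwC z hz'
        rw [Set.mem_ofPred_eq, ← C.cons_tail_support, List.mem_cons] at this
        exact this.resolve_left fun h => hu (h ▸ hz')
      have := (hw.support_nodup.subperm hsub).length_le
      simp only [List.length_tail, Walk.length_support] at this
      omega
    have hne : {e | e ∈ w.edges} ≠ {e | e ∈ C.edges} := by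
      intro h
      have hmem : s(u, C.snd) ∈ {e | e ∈ C.edges} := C.mk_start_snd_mem_edges hC.not_nil
      rw [← h] at hmem
      exact hu (w.fst_mem_support_of_mem_edges hmem)
    have := hG w C hw hC hwl hl hne x w.start_mem_support x (hwC x w.start_mem_support)
    simp at this

/-- The vertices of a cycle whose drawing is the boundary of a plane set lie on
that set. -/
theorem IsPlaneEmbedding.vertexOnFace_of_mem_support {G : SimpleGraph V} {vtx : V → ℝ × ℝ}
    {arc : V → V → ℝ → ℝ × ℝ} (h : IsPlaneEmbedding G vtx arc) {D : Set (ℝ × ℝ)} {u v : V}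
    {C : G.Walk u u} (hC : C.IsCycle) (hD : frontier D = WalkDrawing G arc C)
    (hv : v ∈ C.support) : VertexOnFace vtx D v := by
  obtain ⟨e, he, hve⟩ := (Walk.mem_support_iff_exists_mem_edges_of_not_nil hC.not_nil).1 hv
  obtain ⟨x, rfl⟩ := Sym2.mem_iff_exists.1 hve
  have hadj : G.Adj v x := C.adj_of_mem_edges he
  rw [VertexOnFace, hD]
  simp only [WalkDrawing, Set.mem_iUnion]
  exact ⟨v, x, hadj, he, 0, by simp, h.arc_start hadj⟩

/-- The super IF-colorings of a union of components of `G[S]` and of the rest,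
which contains `Q`, glue to one of `G[S]`. -/
theorem SuperIFColoringOn.glue {G : SimpleGraph V} {v : V} {B Q Q' : Set V}
    (hB : ∀ x y, JoinedAvoiding G v x y → (x ∈ B ↔ y ∈ B)) (hQB : ∀ x ∈ Q, x ∉ B)
    {c c' : V → Bool} (hc : SuperIFColoringOn G {x | x ≠ v ∧ x ∉ B} Q c)
    (hc' : SuperIFColoringOn G B Q' c') [DecidablePred (· ∈ B)] :
    SuperIFColoringOn G {v}ᶜ Q fun x => if x ∈ B then c' x else c x := by
  obtain ⟨⟨hI, hF⟩, hsplit⟩ := hc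
  obtain ⟨⟨hI', hF'⟩, -⟩ := hc'
  have walk_iff : ∀ {x y : V} (w : G.Walk x y), (∀ z ∈ w.support, z ∈ ({v}ᶜ : Set V)) →
      ∀ z ∈ w.support, (x ∈ B ↔ z ∈ B) := fun w hw z hz =>
    hB _ _ (joinedAvoiding_of_mem_support (fun h => hw v h rfl) hz)
  refine ⟨⟨?_, ?_⟩, ?_⟩
  · intro x y hx hy hxy hxI
    have hiff := walk_iff (.cons hxy .nil) (by simpa using ⟨hx, hy⟩) y (by simp)
    by_cases h : x ∈ B
    · simp only [h, hiff.1 h, if_true] at hxI ⊢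
      exact hI' h (hiff.1 h) hxy hxI
    · have h' := mt hiff.2 h
      simp only [h, h', if_false] at hxI ⊢
      exact hI ⟨hx, h⟩ ⟨hy, h'⟩ hxy hxI
  · intro x w hw hwS hwF
    by_cases h : x ∈ B
    · have hwB : ∀ z ∈ w.support, z ∈ B := fun z hz => (walk_iff w hwS z hz).1 h
      refine hF' x w hw hwB fun z hz => ?_
      simpa [hwB z hz] using hwF z hz
    · have hwB : ∀ z ∈ w.support, z ∉ B := fun z hz => mt (walk_iff w hwS z hz).2 h
      refine hF x w hw (fun z hz => ⟨hwS z hz, hwB z hz⟩) fun z hz => ?_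
      simpa [hwB z hz] using hwF z hz
  · rintro a b p hpS ⟨hp, hpF, ha, hb, hl, hint⟩
    have hpB : ∀ z ∈ p.support, z ∉ B := fun z hz => mt (walk_iff p hpS z hz).2 (hQB a ha)
    refine hsplit a b p (fun z hz => ⟨hpS z hz, hpB z hz⟩)
      ⟨hp, fun z hz => ?_, ha, hb, hl, hint⟩
    simpa [hpB z hz] using hpF z hz

/-- In a minimal counterexample, the precoloring extends to the deletion of any
vertex of degree at most two off the precolored cycle. -/
theorem IsMinimalCounterexample.exists_superIFColoringOn_compl [Fintype V] {G : SimpleGraph V}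
    {v0 : V} {C0 : G.Walk v0 v0} {φ0 : V → Bool} (hmin : IsMinimalCounterexample G C0 φ0)
    {v : V} [Fintype (G.neighborSet v)] (hdeg : G.degree v < 3) (hv : v ∉ C0.support) :
    ∃ c : V → Bool, SuperIFColoringOn G {v}ᶜ {x | x ∈ C0.support} c ∧
      ∀ x ∈ C0.support, c x = φ0 x := by
  classical
  obtain ⟨-, hG, hgood, hlen, hφ, -⟩ := hmin.1
  have mem_ne : ∀ {x : V}, x ∈ C0.support → x ≠ v := fun hx h => hv (h ▸ hx)
  by_cases hjoin : ShortCyclesJoinedIn G {v}ᶜ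
  · exact hmin.exists_superIFColoringOn (by simp) hjoin C0 (fun x hx => mem_ne hx) hgood hlen hφ
  obtain ⟨t, C, x, y, hC, hCl, hCv, hyC, hyx, hnyx, hny0⟩ : ∃ (t : V) (C : G.Walk t t) (x y : V),
      C.IsCycle ∧ C.length ≤ 5 ∧ v ∉ C.support ∧ y ∈ C.support ∧ G.Reachable y x ∧
      ¬ JoinedAvoiding G v y x ∧ ¬ JoinedAvoiding G v y v0 := by
    simp only [ShortCyclesJoinedIn] at hjoin
    push Not at hjoin
    obtain ⟨s, t, c1, c2, h1, h2, l1, l2, hne, hs1, hs2, x, hx, y, hy, hxy⟩ := hjoin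
    have hr := hG.reachable h1 h2 l1 l2 hne hx hy
    have hnot : ¬ JoinedAvoiding G v x y := by
      rintro ⟨w, hw⟩
      obtain ⟨z, hz, hz'⟩ := hxy w
      exact hz' fun h => hw (h ▸ hz)
    by_cases h0 : JoinedAvoiding G v y v0
    · exact ⟨s, c1, y, x, h1, l1, fun h => hs1 v h rfl, hx, hr, hnot,
        fun h => hnot (h.trans h0.symm)⟩
    · exact ⟨t, c2, x, y, h2, l2, fun h => hs2 v h rfl, hy, hr.symm, fun h => hnot h.symm, h0⟩
  let B : Set V := {z | JoinedAvoiding G v y z}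
  have hyv : y ≠ v := fun h => hCv (h ▸ hyC)
  have hvB : v ∉ B := fun ⟨w, hw⟩ => hw w.end_mem_support
  have hB : ∀ p q, JoinedAvoiding G v p q → (p ∈ B ↔ q ∈ B) := fun p q h =>
    ⟨fun hp => JoinedAvoiding.trans hp h, fun hq => JoinedAvoiding.trans hq h.symm⟩
  have hCB : ∀ z ∈ C.support, z ∈ B := fun z hz =>
    (joinedAvoiding_of_mem_support hCv hyC).symm.trans (joinedAvoiding_of_mem_support hCv hz)
  have h0B : ∀ z ∈ C0.support, z ∉ B := fun z hz h =>
    hny0 (JoinedAvoiding.trans h (joinedAvoiding_of_mem_support hv hz).symm)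
  have hjoinB : ShortCyclesJoinedIn G B := by
    intro _ _ c1 c2 _ _ _ _ _ hs1 hs2 p hp q hq
    obtain ⟨w, hw⟩ := JoinedAvoiding.trans (JoinedAvoiding.symm (hs1 p hp)) (hs2 q hq)
    exact ⟨w, fun z hz => (hB _ _ (joinedAvoiding_of_mem_support hw hz)).1 (hs1 p hp)⟩
  have hjoinA : ShortCyclesJoinedIn G {z | z ≠ v ∧ z ∉ B} := by
    intro _ _ c1 c2 h1 h2 l1 l2 hne hs1 hs2 p hp q hq
    obtain ⟨w, hw⟩ := joinedAvoiding_of_degree_lt_three hdeg hyv (hs1 p hp).1 (hs2 q hq).1 hyx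
      (hG.reachable h1 h2 l1 l2 hne hp hq) hnyx (hs1 p hp).2 (hs2 q hq).2
    exact ⟨w, fun z hz => ⟨fun h => hw (h ▸ hz),
      mt (hB _ _ (joinedAvoiding_of_mem_support hw hz)).2 (hs1 p hp).2⟩⟩
  obtain ⟨c, hc, hagree⟩ := hmin.exists_superIFColoringOn
    ((Set.ne_univ_iff_exists_notMem _).2 ⟨v, by simp⟩) hjoinA C0
    (fun z hz => ⟨mem_ne hz, h0B z hz⟩) hgood hlen hφ
  obtain ⟨c', hc', -⟩ := hmin.exists_superIFColoringOn
    ((Set.ne_univ_iff_exists_notMem _).2 ⟨v, hvB⟩) hjoinB C hCB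
    ⟨hC, fun h => by have := h.2.1; omega⟩ (by omega) (hG.ifColoringOn_support hC hCl)
  refine ⟨_, hc.glue hB h0B hc', fun z hz => ?_⟩
  simp only [h0B z hz, if_false]
  exact hagree z hz

/-- In a minimal counterexample `(G, C0, φ0)` to the extension
theorem, embedded in the plane so that the chordless cycle `C0` bounds the
outer face `D`, every internal vertex (one not on the outer face) has degree
at least `3`. -/
theorem internal_vertex_min_degree {V : Type} [Fintype V] [DecidableEq V]
    (G : SimpleGraph V) [DecidableRel G.Adj]
    {v0 : V} (C0 : G.Walk v0 v0) (φ0 : V → Bool)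
    (hmin : IsMinimalCounterexample G C0 φ0)
    (vtx : V → ℝ × ℝ) (arc : V → V → ℝ → ℝ × ℝ)
    (hemb : IsPlaneEmbedding G vtx arc)
    (hchordless : Chordless G C0)
    (D : Set (ℝ × ℝ)) (hD : IsOuterFace G vtx arc D)
    (hbound : frontier D = WalkDrawing G arc C0) :
    ∀ v : V, ¬ VertexOnFace vtx D v → 3 ≤ G.degree v := by
  intro v hv
  by_contra! hdeg
  have hvC : v ∉ C0.support := fun h =>
    hv (hemb.vertexOnFace_of_mem_support hmin.1.2.2.1.1 hbound h)
  obtain ⟨c, hc, hagree⟩ := hmin.exists_superIFColoringOn_compl hdeg hvC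
  obtain ⟨c', hc', hagree'⟩ := hc.extend_vertex hdeg hvC
  refine hmin.1.2.2.2.2.2 ⟨c', hc', fun x hx => ?_⟩
  rw [hagree' x fun h => hvC (h ▸ hx), hagree x hx]

end IFPaper
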